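/- Let n ≥ 3 and 0 < λ ≤ Λ, set ñ = (λ/Λ)(n−1) + 1, and let p > 1 satisfy p ≤ ñ/(ñ−2) if ñ > 2 (any p > 1 if ñ ≤ 2). Then there exists a constant C > 0, depending only on n, p, λ, Λ, such that for every open connected set Ω ⊆ ℝⁿ with Ω ≠ ℝⁿ and every nonnegative u ∈ C²(Ω) satisfying M⁺_{λ,Λ}(D²u(x)) + u(x)^p = 0 for all x ∈ Ω, one has u(x) + |∇u(x)|^{2/(p+1)} ≤ C · dist(x, ∂Ω)^{−2/(p−1)} for all x ∈ Ω. -/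

import Mathlib

open scoped BigOperators

/-- The Pucci maximal operator `M⁺_{λ,Λ}`: for a symmetric matrix it equals
`Λ · (sum of positive eigenvalues) + λ · (sum of negative eigenvalues)`. -/
noncomputable def pucciMax (lam Lam : ℝ) {n : ℕ} (M : Matrix (Fin n) (Fin n) ℝ) : ℝ :=
  if h : M.IsHermitian then
    ∑ i, (Lam * max (h.eigenvalues i) 0 + lam * min (h.eigenvalues i) 0)
  else 0

/-- The Hessian matrix of `φ` at `x`. -/
noncomputable def hess {n : ℕ} (φ : EuclideanSpace ℝ (Fin n) → ℝ)
    (x : EuclideanSpace ℝ (Fin n)) : Matrix (Fin n) (Fin n) ℝ :=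
  fun i j => iteratedFDeriv ℝ 2 φ x ![EuclideanSpace.single i 1, EuclideanSpace.single j 1]

open Set Filter Topology Metric

/-- The scalar function whose sum over the eigenvalues is the Pucci maximal operator. -/
noncomputable def pucciScalar (lam Lam t : ℝ) : ℝ := Lam * max t 0 + lam * min t 0

/-- The second derivative of `u` at `x` in the direction `ξ`. -/
noncomputable def secondDeriv {n : ℕ} (u : EuclideanSpace ℝ (Fin n) → ℝ)
    (x ξ : EuclideanSpace ℝ (Fin n)) : ℝ :=
  fderiv ℝ (fderiv ℝ u) x ξ ξ

/-- The variational description of the value of the Pucci maximal operator on a quadratic form `Q`: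
it is the maximum over orthonormal bases of the sum of `pucciScalar` along the diagonal. -/
structure HasPucciValue (lam Lam : ℝ) {n : ℕ} (Q : EuclideanSpace ℝ (Fin n) → ℝ) (v : ℝ) :
    Prop where
  sum_le : ∀ b : OrthonormalBasis (Fin n) ℝ (EuclideanSpace ℝ (Fin n)),
    ∑ i, pucciScalar lam Lam (Q (b i)) ≤ v
  exists_eq : ∃ b : OrthonormalBasis (Fin n) ℝ (EuclideanSpace ℝ (Fin n)),
    ∑ i, pucciScalar lam Lam (Q (b i)) = v
  sum_eq_sum : ∀ b b' : OrthonormalBasis (Fin n) ℝ (EuclideanSpace ℝ (Fin n)),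
    ∑ i, Q (b i) = ∑ i, Q (b' i)

section Scalar

variable {lam Lam : ℝ}

lemma pucciScalar_eq_max (h : lam ≤ Lam) (t : ℝ) :
    pucciScalar lam Lam t = max (Lam * t) (lam * t) := by
  unfold pucciScalar
  rcases le_total t 0 with ht | ht
  · rw [max_eq_right ht, min_eq_left ht, max_eq_right (by nlinarith)]; ring
  · rw [max_eq_left ht, min_eq_right ht, max_eq_left (by nlinarith)]; ring

lemma pucciScalar_mono (h0 : 0 ≤ lam) (h : lam ≤ Lam) : Monotone (pucciScalar lam Lam) := by
  intro s t hst
  have : 0 ≤ Lam := h0.trans h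
  simp only [pucciScalar_eq_max h]
  gcongr

lemma convexOn_pucciScalar (h : lam ≤ Lam) : ConvexOn ℝ univ (pucciScalar lam Lam) := by
  have e : pucciScalar lam Lam = (fun t => Lam * t) ⊔ (fun t => lam * t) := by
    ext t; simp [pucciScalar_eq_max h]
  rw [e]
  exact ((LinearMap.mulLeft ℝ Lam).convexOn convex_univ).sup
    ((LinearMap.mulLeft ℝ lam).convexOn convex_univ)

lemma pucciScalar_sub_le (h : lam ≤ Lam) {s t c : ℝ} (hc : 0 ≤ c) (hst : s - t ≤ c) :
    pucciScalar lam Lam s - pucciScalar lam Lam t ≤ lam * (s - t) + (Lam - lam) * c := by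
  simp only [pucciScalar_eq_max h]
  have h1 := le_max_left (Lam * t) (lam * t)
  have h2 := le_max_right (Lam * t) (lam * t)
  rcases max_cases (Lam * s) (lam * s) with ⟨e, _⟩ | ⟨e, _⟩ <;> rw [e] <;> nlinarith

lemma pucciScalar_mul (c t : ℝ) (hc : 0 ≤ c) :
    pucciScalar lam Lam (c * t) = c * pucciScalar lam Lam t := by
  unfold pucciScalar
  have h1 : max (c * t) 0 = c * max t 0 := by rw [mul_max_of_nonneg _ _ hc, mul_zero]
  have h2 : min (c * t) 0 = c * min t 0 := by rw [mul_min_of_nonneg _ _ hc, mul_zero]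
  rw [h1, h2]; ring

end Scalar

section Pucci

variable {n : ℕ} {lam Lam : ℝ}

lemma hess_apply (u : EuclideanSpace ℝ (Fin n) → ℝ) (x : EuclideanSpace ℝ (Fin n)) (i j : Fin n) :
    hess u x i j = fderiv ℝ (fderiv ℝ u) x (EuclideanSpace.single i 1)
      (EuclideanSpace.single j 1) := by
  simp [hess, iteratedFDeriv_two_apply]

lemma isHermitian_hess {u : EuclideanSpace ℝ (Fin n) → ℝ} {x : EuclideanSpace ℝ (Fin n)}
    (hu : ContDiffAt ℝ 2 u x) : (hess u x).IsHermitian := by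
  have hs := hu.isSymmSndFDerivAt (by simp)
  ext i j
  simpa [hess_apply] using hs _ _

lemma inner_toEuclideanLin_hess {u : EuclideanSpace ℝ (Fin n) → ℝ} (x ξ : EuclideanSpace ℝ (Fin n)) :
    inner ℝ ξ (Matrix.toEuclideanLin (hess u x) ξ) = secondDeriv u x ξ := by
  have hξ : ξ = ∑ i, ξ i • EuclideanSpace.single i (1 : ℝ) := by
    ext j
    simp [Finset.sum_apply, Pi.single_apply]
  have h1 : secondDeriv u x ξ = ∑ i, ∑ j, ξ i * ξ j * hess u x i j := by
    unfold secondDeriv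
    conv_lhs => rw [hξ]
    simp [hess_apply, Finset.mul_sum, mul_assoc]
    rw [Finset.sum_comm]
    refine Finset.sum_congr rfl fun i _ => Finset.sum_congr rfl fun j _ => by ring
  rw [h1, PiLp.inner_apply]
  refine Finset.sum_congr rfl fun i _ => ?_
  simp [Matrix.toLpLin_apply, Matrix.mulVec, dotProduct, Finset.sum_mul]
  refine Finset.sum_congr rfl fun j _ => by ring

lemma hasPucciValue_hess (h : lam ≤ Lam) {u : EuclideanSpace ℝ (Fin n) → ℝ}
    {x : EuclideanSpace ℝ (Fin n)} (hu : ContDiffAt ℝ 2 u x) :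
    HasPucciValue lam Lam (secondDeriv u x) (pucciMax lam Lam (hess u x)) := by
  have hH := isHermitian_hess hu
  have hval : pucciMax lam Lam (hess u x) = ∑ i, pucciScalar lam Lam (hH.eigenvalues i) := by
    rw [pucciMax, dif_pos hH]
    rfl
  set T := Matrix.toEuclideanLin (hess u x) with hT
  set v := hH.eigenvectorBasis with hv
  have hTv : ∀ i, T (v i) = hH.eigenvalues i • v i := by
    intro i
    have := hH.mulVec_eigenvectorBasis i
    ext j
    simpa [hT, Matrix.toLpLin_apply] using congrFun this j
  have hTs : ∀ a b, inner ℝ (T a) b = inner ℝ a (T b) :=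
    Matrix.isSymmetric_toEuclideanLin_iff.2 hH
  have hvv : ∀ i, secondDeriv u x (v i) = hH.eigenvalues i := by
    intro i
    rw [← inner_toEuclideanLin_hess, ← hT, hTv, inner_smul_right, real_inner_self_eq_norm_sq]
    simp
  have hη : ∀ η, secondDeriv u x η = ∑ i, (inner ℝ (v i) η) ^ 2 * hH.eigenvalues i := by
    intro η
    rw [← inner_toEuclideanLin_hess, ← hT, ← v.sum_inner_mul_inner]
    refine Finset.sum_congr rfl fun i _ => ?_
    rw [← hTs, hTv, inner_smul_left, real_inner_comm]
    simp; ring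
  refine ⟨fun b => ?_, ⟨v, by simp only [hvv, hval]⟩, fun b b' => ?_⟩
  · rw [hval]
    calc ∑ k, pucciScalar lam Lam (secondDeriv u x (b k))
        ≤ ∑ k, ∑ i, (inner ℝ (v i) (b k)) ^ 2 * pucciScalar lam Lam (hH.eigenvalues i) := by
          refine Finset.sum_le_sum fun k _ => ?_
          rw [hη]
          refine (convexOn_pucciScalar h).map_sum_le (fun i _ => sq_nonneg _) ?_ (by simp)
          have := v.sum_sq_norm_inner_right (b k)
          simpa using this
      _ = ∑ i, pucciScalar lam Lam (hH.eigenvalues i) := by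
          rw [Finset.sum_comm]
          refine Finset.sum_congr rfl fun i _ => ?_
          rw [← Finset.sum_mul]
          have := b.sum_sq_norm_inner_left (v i)
          simp only [Real.norm_eq_abs, sq_abs, v.norm_eq_one] at this
          rw [this]; simp
  · simp only [← inner_toEuclideanLin_hess, ← LinearMap.trace_eq_sum_inner]

lemma HasPucciValue.const_mul {Q : EuclideanSpace ℝ (Fin n) → ℝ} {v : ℝ}
    (hQ : HasPucciValue lam Lam Q v) {c : ℝ} (hc : 0 ≤ c) :
    HasPucciValue lam Lam (fun ξ => c * Q ξ) (c * v) := by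
  refine ⟨fun b => ?_, ?_, fun b b' => ?_⟩
  · simp only [pucciScalar_mul _ _ hc, ← Finset.mul_sum]
    exact mul_le_mul_of_nonneg_left (hQ.sum_le b) hc
  · obtain ⟨b, hb⟩ := hQ.exists_eq
    refine ⟨b, ?_⟩
    simp only [pucciScalar_mul _ _ hc, ← Finset.mul_sum, hb]
  · simp only [← Finset.mul_sum, hQ.sum_eq_sum b b']

lemma exists_orthonormalBasis_apply_eq {e : EuclideanSpace ℝ (Fin n)} (he : ‖e‖ = 1) :
    ∃ (b : OrthonormalBasis (Fin n) ℝ (EuclideanSpace ℝ (Fin n))) (i : Fin n), b i = e := by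
  have hn : 0 < n := by
    rcases Nat.eq_zero_or_pos n with rfl | hn
    · simp [Subsingleton.elim e 0] at he
    · exact hn
  have i0 : Fin n := ⟨0, hn⟩
  obtain ⟨b, hb⟩ := Orthonormal.exists_orthonormalBasis_extension_of_card_eq (𝕜 := ℝ)
    (E := EuclideanSpace ℝ (Fin n)) (ι := Fin n) (by simp) (v := fun _ => e) (s := {i0})
    ⟨fun i => by simpa using he, fun i j hij => absurd (Subsingleton.elim i j) hij⟩
  exact ⟨b, i0, hb i0 (by simp)⟩

/-- If `Q₁ - Q₂ ≤ c |ξ|²` and `Q₁ - Q₂ ≤ m` in one unit direction, then the Pucci values of `Q₁` and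
`Q₂` are ordered up to an explicit error. -/
lemma HasPucciValue.sub_le (h0 : 0 ≤ lam) (h : lam ≤ Lam)
    {Q₁ Q₂ : EuclideanSpace ℝ (Fin n) → ℝ} {v₁ v₂ c m : ℝ}
    (h₁ : HasPucciValue lam Lam Q₁ v₁) (h₂ : HasPucciValue lam Lam Q₂ v₂) (hc : 0 ≤ c)
    (hle : ∀ ξ, ‖ξ‖ = 1 → Q₁ ξ - Q₂ ξ ≤ c) {e : EuclideanSpace ℝ (Fin n)} (he : ‖e‖ = 1)
    (hm : Q₁ e - Q₂ e ≤ m) :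
    v₁ - v₂ ≤ lam * (m - c) + n * Lam * c := by
  obtain ⟨b, hb⟩ := h₁.exists_eq
  obtain ⟨b', i0, hb'⟩ := exists_orthonormalBasis_apply_eq he
  have htr : ∑ i, (Q₁ (b i) - Q₂ (b i)) ≤ (m - c) + n * c := by
    rw [Finset.sum_sub_distrib, h₁.sum_eq_sum b b', h₂.sum_eq_sum b b', ← Finset.sum_sub_distrib]
    have : ∀ i ∈ Finset.univ, Q₁ (b' i) - Q₂ (b' i) ≤ c + if i = i0 then m - c else 0 := by
      intro i _
      split_ifs with hi
      · rw [hi, hb']; linarith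
      · simpa using hle _ (b'.norm_eq_one i)
    refine (Finset.sum_le_sum this).trans ?_
    rw [Finset.sum_add_distrib]
    simp
    linarith
  have hkey : v₁ - v₂ ≤ ∑ i, (lam * (Q₁ (b i) - Q₂ (b i)) + (Lam - lam) * c) := by
    have := h₂.sum_le b
    calc v₁ - v₂ ≤ ∑ i, (pucciScalar lam Lam (Q₁ (b i)) - pucciScalar lam Lam (Q₂ (b i))) := by
          rw [Finset.sum_sub_distrib]; linarith
      _ ≤ _ := Finset.sum_le_sum fun i _ =>
          pucciScalar_sub_le h hc (hle _ (b.norm_eq_one i))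
  rw [Finset.sum_add_distrib, ← Finset.mul_sum] at hkey
  simp only [Finset.sum_const, Finset.card_univ, Fintype.card_fin, nsmul_eq_mul] at hkey
  nlinarith [mul_le_mul_of_nonneg_left htr h0]

/-- A lower bound for the Pucci value from lower bounds in a unit direction and in its orthogonal
complement. -/
lemma HasPucciValue.le_of_radial (h0 : 0 ≤ lam) (h : lam ≤ Lam)
    {Q : EuclideanSpace ℝ (Fin n) → ℝ} {v s t : ℝ}
    (hQ : HasPucciValue lam Lam Q v) {e : EuclideanSpace ℝ (Fin n)} (he : ‖e‖ = 1)
    (hs : s ≤ Q e) (ht : ∀ ξ, ‖ξ‖ = 1 → inner ℝ e ξ = 0 → t ≤ Q ξ) :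
    Lam * s + lam * (n - 1) * t ≤ v := by
  obtain ⟨b, i0, hb⟩ := exists_orthonormalBasis_apply_eq he
  refine le_trans ?_ (hQ.sum_le b)
  have : ∀ i ∈ Finset.univ, lam * t + (if i = i0 then Lam * s - lam * t else 0) ≤
      pucciScalar lam Lam (Q (b i)) := by
    intro i _
    split_ifs with hi
    · rw [hi, hb]
      refine le_trans ?_ (pucciScalar_mono h0 h hs)
      rw [pucciScalar_eq_max h]
      linarith [le_max_left (Lam * s) (lam * s)]
    · have hti : t ≤ Q (b i) := by
        refine ht _ (b.norm_eq_one i) ?_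
        rw [← hb]
        exact b.orthonormal.2 (Ne.symm hi)
      refine le_trans ?_ (pucciScalar_mono h0 h hti)
      rw [pucciScalar_eq_max h]
      linarith [le_max_right (Lam * t) (lam * t)]
  refine le_trans (le_of_eq ?_) (Finset.sum_le_sum this)
  rw [Finset.sum_add_distrib]
  simp
  ring

end Pucci

section SecondDeriv

/-- `h` is differentiable near `0` and its derivative has derivative `c` at `0`. -/
def HasSecondDerivAtZero (h : ℝ → ℝ) (c : ℝ) : Prop :=
  ∃ h' : ℝ → ℝ, (∀ᶠ s in 𝓝 0, HasDerivAt h (h' s) s) ∧ HasDerivAt h' c 0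

lemma HasSecondDerivAtZero.sub {f g : ℝ → ℝ} {a b : ℝ} (hf : HasSecondDerivAtZero f a)
    (hg : HasSecondDerivAtZero g b) : HasSecondDerivAtZero (fun s => f s - g s) (a - b) := by
  obtain ⟨f', hf1, hf2⟩ := hf
  obtain ⟨g', hg1, hg2⟩ := hg
  refine ⟨fun s => f' s - g' s, ?_, hf2.sub hg2⟩
  filter_upwards [hf1, hg1] with s h1 h2 using h1.sub h2

lemma HasSecondDerivAtZero.const_mul {f : ℝ → ℝ} {a : ℝ} (c : ℝ)
    (hf : HasSecondDerivAtZero f a) : HasSecondDerivAtZero (fun s => c * f s) (c * a) := by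
  obtain ⟨f', hf1, hf2⟩ := hf
  refine ⟨fun s => c * f' s, ?_, hf2.const_mul c⟩
  filter_upwards [hf1] with s h1 using h1.const_mul c

lemma hasSecondDerivAtZero_quadratic (b c : ℝ) :
    HasSecondDerivAtZero (fun s => b * s + c * s ^ 2) (2 * c) := by
  refine ⟨fun s => b + 2 * c * s, Eventually.of_forall fun s => ?_, ?_⟩
  · have := ((hasDerivAt_id s).const_mul b).add (((hasDerivAt_id s).pow 2).const_mul c)
    refine this.congr_deriv ?_
    simp; ring
  · have := ((hasDerivAt_id (0 : ℝ)).const_mul (2 * c)).const_add b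
    simpa using this

lemma HasSecondDerivAtZero.deriv_deriv {f : ℝ → ℝ} {a : ℝ} (hf : HasSecondDerivAtZero f a) :
    deriv (deriv f) 0 = a := by
  obtain ⟨f', hf1, hf2⟩ := hf
  have : deriv f =ᶠ[𝓝 0] f' := by
    filter_upwards [hf1] with s hs using hs.deriv
  rw [this.deriv_eq, hf2.deriv]

lemma HasSecondDerivAtZero.nonneg {f : ℝ → ℝ} {a : ℝ} (hf : HasSecondDerivAtZero f a)
    (hmin : IsLocalMin f 0) : 0 ≤ a := by
  by_contra! ha
  have h2 := hf.deriv_deriv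
  obtain ⟨f', hf1, hf2⟩ := id hf
  have hmax := isLocalMax_of_deriv_deriv_neg (h2 ▸ ha) hmin.deriv_eq_zero
    hf1.self_of_nhds.continuousAt
  have hc : f =ᶠ[𝓝 0] fun _ => f 0 := by
    filter_upwards [hmin, hmax] with s h1 h3 using le_antisymm h3 h1
  have : deriv f =ᶠ[𝓝 0] fun _ => 0 := by
    filter_upwards [hc.eventuallyEq_nhds] with s hs
    rw [hs.deriv_eq, deriv_const]
  rw [this.deriv_eq, deriv_const] at h2
  linarith

lemma HasSecondDerivAtZero.sub_le {f g : ℝ → ℝ} {a d b c : ℝ} (hf : HasSecondDerivAtZero f a)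
    (hg : HasSecondDerivAtZero g d)
    (h : ∀ᶠ s in 𝓝 (0 : ℝ), f s - g s ≤ f 0 - g 0 + (b * s + c * s ^ 2)) : a - d ≤ 2 * c := by
  have := ((hasSecondDerivAtZero_quadratic b c).sub (hf.sub hg)).nonneg (by
    filter_upwards [h] with s hs
    simp
    linarith)
  linarith

variable {n : ℕ}

lemma hasSecondDerivAtZero_line {u : EuclideanSpace ℝ (Fin n) → ℝ} {x : EuclideanSpace ℝ (Fin n)}
    (hu : ContDiffAt ℝ 2 u x) (ξ : EuclideanSpace ℝ (Fin n)) :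
    HasSecondDerivAtZero (fun s => u (x + s • ξ)) (secondDeriv u x ξ) := by
  have hl : ∀ s : ℝ, HasDerivAt (fun s : ℝ => x + s • ξ) ξ s := fun s => by
    simpa using ((hasDerivAt_id s).smul_const ξ).const_add x
  refine ⟨fun s => fderiv ℝ u (x + s • ξ) ξ, ?_, ?_⟩
  · have h1 : ∀ᶠ z in 𝓝 x, ContDiffAt ℝ 2 u z := hu.eventually (by simp)
    have hc : Tendsto (fun s : ℝ => x + s • ξ) (𝓝 0) (𝓝 x) := by
      simpa using (hl 0).continuousAt.tendsto
    filter_upwards [hc.eventually h1] with s hs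
    exact (hs.differentiableAt (by simp)).hasFDerivAt.comp_hasDerivAt s (hl s)
  · have h1 : DifferentiableAt ℝ (fderiv ℝ u) (x + (0 : ℝ) • ξ) := by
      simpa using (hu.fderiv_right (m := 1) (by norm_num)).differentiableAt (by simp)
    have h2 := h1.hasFDerivAt.comp_hasDerivAt (0 : ℝ) (hl 0)
    have h3 := h2.clm_apply (hasDerivAt_const (0 : ℝ) ξ)
    simpa [secondDeriv] using h3

lemma secondDeriv_smul (u : EuclideanSpace ℝ (Fin n) → ℝ) (x ξ : EuclideanSpace ℝ (Fin n))
    (a : ℝ) : secondDeriv u x (a • ξ) = a ^ 2 * secondDeriv u x ξ := by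
  simp [secondDeriv]; ring

lemma secondDeriv_rescale {u : EuclideanSpace ℝ (Fin n) → ℝ} {y z : EuclideanSpace ℝ (Fin n)}
    {a : ℝ} (c : ℝ) (hu : ContDiffAt ℝ 2 u (y + a • z)) (ξ : EuclideanSpace ℝ (Fin n)) :
    secondDeriv (fun z => c * u (y + a • z)) z ξ = c * a ^ 2 * secondDeriv u (y + a • z) ξ := by
  have hw : ContDiffAt ℝ 2 (fun z => c * u (y + a • z)) z := by
    refine contDiffAt_const.mul (ContDiffAt.comp z (f := fun z => y + a • z) hu ?_)
    fun_prop
  have h1 := (hasSecondDerivAtZero_line hw ξ).deriv_deriv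
  have h2 := ((hasSecondDerivAtZero_line hu (a • ξ)).const_mul c).deriv_deriv
  rw [secondDeriv_smul] at h2
  rw [← h1, mul_assoc, ← h2]
  congr 2
  ext s
  congr 2
  module

end SecondDeriv

section Lipschitz

variable {n : ℕ} {lam Lam : ℝ}

/-- Interior Lipschitz estimate by doubling of variables. -/
lemma sub_le_of_hasPucciValue (h0 : 0 < lam) (h : lam ≤ Lam) {A F L : ℝ}
    {u v : EuclideanSpace ℝ (Fin n) → ℝ}
    (hu : ContDiffOn ℝ 2 u (ball 0 2)) (hu0 : ∀ x ∈ ball 0 2, 0 ≤ u x)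
    (huA : ∀ x ∈ ball 0 2, u x ≤ A)
    (hv : ∀ x ∈ ball 0 2, HasPucciValue lam Lam (secondDeriv u x) (v x))
    (hvF : ∀ x ∈ ball 0 2, |v x| ≤ F) (hL : 4 * n * Lam * A + 2 * F < lam * L)
    {x y : EuclideanSpace ℝ (Fin n)} (hx : x ∈ closedBall 0 1) (hy : y ∈ closedBall 0 1) :
    u x - u y ≤ L * ‖x - y‖ + A * (‖x‖ ^ 2 + ‖y‖ ^ 2) := by
  have hsub : closedBall (0 : EuclideanSpace ℝ (Fin n)) 1 ⊆ ball 0 2 :=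
    closedBall_subset_ball (by norm_num)
  have hA : 0 ≤ A := (hu0 x (hsub hx)).trans (huA x (hsub hx))
  have hF : 0 ≤ F := (abs_nonneg _).trans (hvF x (hsub hx))
  have hLam : 0 < Lam := h0.trans_le h
  have hL0 : 0 < L := by
    by_contra! hneg
    have : 0 ≤ 4 * n * Lam * A := by positivity
    nlinarith
  by_contra! hcon
  set Φ : EuclideanSpace ℝ (Fin n) × EuclideanSpace ℝ (Fin n) → ℝ := fun q =>
    u q.1 - u q.2 - L * (‖q.1 - q.2‖ - ‖q.1 - q.2‖ ^ 2 / 8) - A * (‖q.1‖ ^ 2 + ‖q.2‖ ^ 2) with hΦ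
  set S : Set (EuclideanSpace ℝ (Fin n) × EuclideanSpace ℝ (Fin n)) :=
    closedBall 0 1 ×ˢ closedBall 0 1 with hS
  have hScomp : IsCompact S := (isCompact_closedBall _ _).prod (isCompact_closedBall _ _)
  have hcont : ContinuousOn Φ S := by
    have hc : ContinuousOn u (closedBall 0 1) := hu.continuousOn.mono hsub
    have h1 : ContinuousOn (fun q : EuclideanSpace ℝ (Fin n) × EuclideanSpace ℝ (Fin n) => u q.1) S :=
      hc.comp continuousOn_fst fun q hq => hq.1
    have h2 : ContinuousOn (fun q : EuclideanSpace ℝ (Fin n) × EuclideanSpace ℝ (Fin n) => u q.2) S :=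
      hc.comp continuousOn_snd fun q hq => hq.2
    refine ((h1.sub h2).sub ?_).sub ?_ <;> fun_prop
  obtain ⟨⟨a, b⟩, hab, hmax⟩ := hScomp.exists_isMaxOn ⟨(x, y), hx, hy⟩ hcont
  rw [isMaxOn_iff] at hmax
  have ha : ‖a‖ ≤ 1 := by simpa using hab.1
  have hb : ‖b‖ ≤ 1 := by simpa using hab.2
  have hpos : 0 < Φ (a, b) := by
    refine lt_of_lt_of_le ?_ (hmax (x, y) (mk_mem_prod hx hy))
    simp only [hΦ]
    nlinarith [sq_nonneg ‖x - y‖]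
  have hφ : 0 ≤ ‖a - b‖ - ‖a - b‖ ^ 2 / 8 := by
    have : ‖a - b‖ ≤ 2 := (norm_sub_le a b).trans (by linarith)
    nlinarith [norm_nonneg (a - b)]
  have hosc : u a - u b ≤ A := by
    linarith [huA a (hsub hab.1), hu0 b (hsub hab.2)]
  have hlt : A * (‖a‖ ^ 2 + ‖b‖ ^ 2) < A := by
    simp only [hΦ] at hpos
    nlinarith
  have ha1 : ‖a‖ < 1 := by
    by_contra! hge
    have : ‖a‖ = 1 := le_antisymm ha hge
    rw [this] at hlt
    nlinarith [mul_nonneg hA (sq_nonneg ‖b‖)]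
  have hb1 : ‖b‖ < 1 := by
    by_contra! hge
    have : ‖b‖ = 1 := le_antisymm hb hge
    rw [this] at hlt
    nlinarith [mul_nonneg hA (sq_nonneg ‖a‖)]
  have hne : a ≠ b := by
    rintro rfl
    simp only [hΦ] at hpos
    simp at hpos
    nlinarith [mul_nonneg hA (sq_nonneg ‖a‖)]
  have hua : ContDiffAt ℝ 2 u a := hu.contDiffAt (isOpen_ball.mem_nhds (hsub hab.1))
  have hub : ContDiffAt ℝ 2 u b := hu.contDiffAt (isOpen_ball.mem_nhds (hsub hab.2))
  have hev : ∀ ξ η : EuclideanSpace ℝ (Fin n),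
      ∀ᶠ s in 𝓝 (0 : ℝ), Φ (a + s • ξ, b + s • η) ≤ Φ (a, b) := by
    intro ξ η
    have h1 : ∀ (c ζ : EuclideanSpace ℝ (Fin n)), ‖c‖ < 1 →
        ∀ᶠ s in 𝓝 (0 : ℝ), c + s • ζ ∈ closedBall (0 : EuclideanSpace ℝ (Fin n)) 1 := by
      intro c ζ hc
      have : Tendsto (fun s : ℝ => c + s • ζ) (𝓝 0) (𝓝 c) := by
        have : Continuous (fun s : ℝ => c + s • ζ) := by fun_prop
        simpa using this.tendsto 0
      exact this.eventually (closedBall_mem_nhds_of_mem (by simpa using hc))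
    filter_upwards [h1 a ξ ha1, h1 b η hb1] with s hs ht
    exact hmax _ (mk_mem_prod hs ht)
  have hnorm : ∀ (c ζ : EuclideanSpace ℝ (Fin n)) (s : ℝ), ‖ζ‖ = 1 →
      ‖c + s • ζ‖ ^ 2 = ‖c‖ ^ 2 + 2 * inner ℝ c ζ * s + s ^ 2 := by
    intro c ζ s hζ
    rw [norm_add_sq_real, inner_smul_right, norm_smul, hζ]
    simp
    ring
  have hpar : ∀ ξ, ‖ξ‖ = 1 → secondDeriv u a ξ - secondDeriv u b ξ ≤ 4 * A := by
    intro ξ hξ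
    have := (hasSecondDerivAtZero_line hua ξ).sub_le (hasSecondDerivAtZero_line hub ξ)
      (b := A * (2 * inner ℝ a ξ + 2 * inner ℝ b ξ)) (c := 2 * A) (by
        filter_upwards [hev ξ ξ] with s hs
        simp only [hΦ, hnorm _ _ _ hξ, add_sub_add_right_eq_sub] at hs
        simp only [zero_smul, add_zero]
        nlinarith)
    linarith
  set t := ‖a - b‖ with ht
  have htpos : 0 < t := norm_pos_iff.2 (sub_ne_zero.2 hne)
  set e := t⁻¹ • (a - b) with he
  have he1 : ‖e‖ = 1 := by
    rw [he, norm_smul, norm_inv, norm_norm, ← ht, inv_mul_cancel₀ htpos.ne']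
  have hte : a - b = t • e := by
    rw [he, smul_smul, mul_inv_cancel₀ htpos.ne', one_smul]
  have hanti : secondDeriv u a e - secondDeriv u b e ≤ 4 * A - L := by
    have := (hasSecondDerivAtZero_line hua e).sub_le (hasSecondDerivAtZero_line hub (-e))
      (b := A * (2 * inner ℝ a e + 2 * inner ℝ b (-e)) + L * (2 - t / 2))
      (c := 2 * A - L / 2) (by
        filter_upwards [hev e (-e), lt_mem_nhds (show -(t / 2) < 0 by linarith)] with s hs hst
        have h3 : ‖a + s • e - (b + s • -e)‖ = t + 2 * s := by
          have : a + s • e - (b + s • -e) = (t + 2 * s) • e := by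
            rw [add_smul, ← hte]; module
          rw [this, norm_smul, he1, mul_one, Real.norm_of_nonneg (by linarith)]
        simp only [hΦ, h3, hnorm _ _ _ he1,
          hnorm b (-e) s (by rw [norm_neg, he1])] at hs
        simp only [zero_smul, add_zero]
        nlinarith)
    have h4 : secondDeriv u b (-e) = secondDeriv u b e := by
      simpa using secondDeriv_smul u b e (-1)
    rw [h4] at this
    linarith
  have := (hv a (hsub hab.1)).sub_le h0.le h (hv b (hsub hab.2)) (c := 4 * A) (by linarith)
    hpar he1 hanti
  have h5 := abs_le.1 (hvF a (hsub hab.1))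
  have h6 := abs_le.1 (hvF b (hsub hab.2))
  nlinarith

end Lipschitz

section Comparison

variable {n : ℕ} {lam Lam p : ℝ}

/-- `u` is a nonnegative `C²` solution of `M⁺(D²u) + u ^ p = 0` in `U`. -/
structure IsPucciSol (lam Lam p : ℝ) (u : EuclideanSpace ℝ (Fin n) → ℝ)
    (U : Set (EuclideanSpace ℝ (Fin n))) : Prop where
  contDiffOn : ContDiffOn ℝ 2 u U
  nonneg : ∀ x ∈ U, 0 ≤ u x
  hasPucciValue : ∀ x ∈ U, HasPucciValue lam Lam (secondDeriv u x) (-(u x) ^ p)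

/-- If a radial function touches `v` from below at `x ≠ 0`, then the radial linear operator
evaluated on it is at most the Pucci value of `v` at `x`. -/
lemma HasPucciValue.radial_le (h0 : 0 ≤ lam) (h : lam ≤ Lam) {v : EuclideanSpace ℝ (Fin n) → ℝ}
    {x : EuclideanSpace ℝ (Fin n)} {val d : ℝ} (hv : ContDiffAt ℝ 2 v x)
    (hP : HasPucciValue lam Lam (secondDeriv v x) val) {f f' : ℝ → ℝ} (hx : x ≠ 0)
    (hf : ∀ᶠ ρ in 𝓝 ‖x‖, HasDerivAt f (f' ρ) ρ) (hf' : HasDerivAt f' d ‖x‖)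
    (hmin : ∀ᶠ z in 𝓝 x, f ‖z‖ - f ‖x‖ ≤ v z - v x) :
    Lam * d + lam * (n - 1) * (f' ‖x‖ / ‖x‖) ≤ val := by
  set r := ‖x‖ with hr
  have hr0 : 0 < r := norm_pos_iff.2 hx
  set e := r⁻¹ • x with he
  have he1 : ‖e‖ = 1 := by
    rw [he, norm_smul, norm_inv, hr, norm_norm, inv_mul_cancel₀ (hr ▸ hr0.ne')]
  have hxe : x = r • e := by rw [he, smul_smul, mul_inv_cancel₀ hr0.ne', one_smul]
  have htend : ∀ ξ : EuclideanSpace ℝ (Fin n),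
      Tendsto (fun s : ℝ => x + s • ξ) (𝓝 0) (𝓝 x) := by
    intro ξ
    have : Continuous (fun s : ℝ => x + s • ξ) := by fun_prop
    simpa using this.tendsto 0
  refine hP.le_of_radial h0 h he1 ?_ fun ξ hξ hort => ?_
  · have h1 : HasSecondDerivAtZero (fun s => f (r + s)) d := by
      refine ⟨fun s => f' (r + s), ?_, ?_⟩
      · have : Tendsto (fun s : ℝ => r + s) (𝓝 0) (𝓝 r) := by
          have : Continuous (fun s : ℝ => r + s) := by fun_prop
          simpa using this.tendsto 0
        filter_upwards [this.eventually hf] with s hs using hs.comp_const_add r s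
      · exact HasDerivAt.comp_const_add r 0 (by simpa using hf')
    have := h1.sub_le (hasSecondDerivAtZero_line hv e) (b := 0) (c := 0) (by
      filter_upwards [(htend e).eventually hmin, lt_mem_nhds (show -r < 0 by linarith)]
        with s hs hsr
      have : ‖x + s • e‖ = r + s := by
        rw [hxe, ← add_smul, norm_smul, he1, mul_one, Real.norm_of_nonneg (by linarith)]
      rw [this] at hs
      simp only [zero_smul, add_zero]
      linarith)
    linarith
  · have hortx : inner ℝ x ξ = 0 := by rw [hxe, inner_smul_left, hort]; simp
    have hpos : ∀ s : ℝ, 0 < r ^ 2 + s ^ 2 := fun s => by positivity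
    have hsq : ∀ s : ℝ, HasDerivAt (fun s => √(r ^ 2 + s ^ 2)) (s / √(r ^ 2 + s ^ 2)) s := by
      intro s
      have := (((hasDerivAt_id s).pow 2).const_add (r ^ 2)).sqrt (hpos s).ne'
      refine this.congr_deriv ?_
      simp
      ring
    have hs0 : √(r ^ 2 + 0 ^ 2) = r := by simp [hr0.le]
    have h1 : HasSecondDerivAtZero (fun s => f √(r ^ 2 + s ^ 2)) (f' r / r) := by
      refine ⟨fun s => f' √(r ^ 2 + s ^ 2) * (s / √(r ^ 2 + s ^ 2)), ?_, ?_⟩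
      · have : Tendsto (fun s : ℝ => √(r ^ 2 + s ^ 2)) (𝓝 0) (𝓝 r) := by
          simpa only [hs0] using (hsq 0).continuousAt.tendsto
        filter_upwards [this.eventually hf] with s hs using hs.comp s (hsq s)
      · have h2 : HasDerivAt (fun s : ℝ => f' √(r ^ 2 + s ^ 2)) (d * (0 / √(r ^ 2 + 0 ^ 2))) 0 :=
          HasDerivAt.comp (0 : ℝ) (h₂ := f') (by rw [hs0]; exact hf') (hsq 0)
        have h3 := (hasDerivAt_id (0 : ℝ)).div (hsq 0) (by rw [hs0]; exact hr0.ne')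
        refine (h2.mul h3).congr_deriv ?_
        simp only [hs0, id]
        field_simp
        simp
        ring
    have := h1.sub_le (hasSecondDerivAtZero_line hv ξ) (b := 0) (c := 0) (by
      filter_upwards [(htend ξ).eventually hmin] with s hs
      have : ‖x + s • ξ‖ = √(r ^ 2 + s ^ 2) := by
        rw [← Real.sqrt_sq (norm_nonneg (x + s • ξ)), norm_add_sq_real, inner_smul_right, hortx,
          norm_smul, hξ]
        simp [hr]
      rw [this] at hs
      simp only [zero_smul, add_zero, hs0]
      linarith)
    linarith

lemma isCompact_closedAnnulus (a b : ℝ) :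
    IsCompact {x : EuclideanSpace ℝ (Fin n) | a ≤ ‖x‖ ∧ ‖x‖ ≤ b} := by
  refine (isCompact_closedBall (0 : EuclideanSpace ℝ (Fin n)) b).of_isClosed_subset ?_ ?_
  · exact (isClosed_le continuous_const continuous_norm).inter
      (isClosed_le continuous_norm continuous_const)
  · intro x hx
    simpa using hx.2

lemma closedAnnulus_mem_nhds {a b : ℝ} {x : EuclideanSpace ℝ (Fin n)} (ha : a < ‖x‖)
    (hb : ‖x‖ < b) : {x : EuclideanSpace ℝ (Fin n) | a ≤ ‖x‖ ∧ ‖x‖ ≤ b} ∈ 𝓝 x := by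
  filter_upwards [continuous_norm.continuousAt.eventually (lt_mem_nhds ha),
    continuous_norm.continuousAt.eventually (gt_mem_nhds hb)] with z h1 h2 using ⟨h1.le, h2.le⟩

/-- Comparison of a supersolution with a strict radial subsolution in an annulus. -/
lemma IsPucciSol.radial_le (h0 : 0 ≤ lam) (h : lam ≤ Lam) {K a b : ℝ}
    {v : EuclideanSpace ℝ (Fin n) → ℝ} (hv : IsPucciSol lam Lam p v (ball 0 K)) (ha : 0 < a)
    (hbK : b < K) {f f' f'' : ℝ → ℝ} (hf : ∀ r > 0, HasDerivAt f (f' r) r)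
    (hf' : ∀ r > 0, HasDerivAt f' (f'' r) r) (hfb : f b ≤ 0)
    (hfa : ∀ x, ‖x‖ = a → f a ≤ v x)
    (hode : ∀ r, a < r → r < b → 0 < Lam * f'' r + lam * (n - 1) * (f' r / r))
    {x : EuclideanSpace ℝ (Fin n)} (hax : a ≤ ‖x‖) (hxb : ‖x‖ ≤ b) : f ‖x‖ ≤ v x := by
  by_contra! hcon
  have hsub : {x : EuclideanSpace ℝ (Fin n) | a ≤ ‖x‖ ∧ ‖x‖ ≤ b} ⊆ ball 0 K := fun z hz => by
    simpa using hz.2.trans_lt hbK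
  have hfc : ContinuousOn (fun z : EuclideanSpace ℝ (Fin n) => f ‖z‖) {x | a ≤ ‖x‖ ∧ ‖x‖ ≤ b} :=
    fun z hz => ((hf ‖z‖ (ha.trans_le hz.1)).continuousAt.comp
      continuous_norm.continuousAt).continuousWithinAt
  obtain ⟨y, hy, hmin⟩ := (isCompact_closedAnnulus a b).exists_isMinOn ⟨x, hax, hxb⟩
    ((hv.contDiffOn.continuousOn.mono hsub).sub hfc)
  rw [isMinOn_iff] at hmin
  have hyneg : v y - f ‖y‖ < 0 := (hmin x ⟨hax, hxb⟩).trans_lt (by simpa using hcon)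
  have hya : a < ‖y‖ := by
    refine lt_of_le_of_ne hy.1 fun he => ?_
    have := hfa y he.symm
    rw [← he] at hyneg
    linarith
  have hyb : ‖y‖ < b := by
    refine lt_of_le_of_ne hy.2 fun he => ?_
    have := hv.nonneg y (hsub hy)
    rw [he] at hyneg
    linarith
  have hy0 : 0 < ‖y‖ := ha.trans hya
  have := (hv.hasPucciValue y (hsub hy)).radial_le h0 h
    (hv.contDiffOn.contDiffAt (isOpen_ball.mem_nhds (hsub hy))) (norm_pos_iff.1 hy0)
    (by filter_upwards [lt_mem_nhds hy0] with ρ hρ using hf ρ hρ) (hf' _ hy0) (by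
      filter_upwards [closedAnnulus_mem_nhds hya hyb] with z hz
      have h3 : v y - f ‖y‖ ≤ v z - f ‖z‖ := hmin z hz
      linarith)
  have h1 := hode _ hya hyb
  have h2 := Real.rpow_nonneg (hv.nonneg y (hsub hy)) p
  linarith

/-- Comparison of a positive solution, viewed as a supersolution of a linear equation with
potential `v ^ (p - 1)`, with a radial function. -/
lemma IsPucciSol.mul_radial_le (h0 : 0 ≤ lam) (h : lam ≤ Lam) {K a b θ : ℝ}
    {v : EuclideanSpace ℝ (Fin n) → ℝ} (hv : IsPucciSol lam Lam p v (ball 0 K)) (ha : 0 < a)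
    (hbK : b < K) (hpos : ∀ x, a ≤ ‖x‖ → ‖x‖ ≤ b → 0 < v x) {f f' f'' W : ℝ → ℝ}
    (hf : ∀ r > 0, HasDerivAt f (f' r) r)
    (hf' : ∀ r > 0, HasDerivAt f' (f'' r) r) (hfb : f b ≤ 0) (hθ : 0 < θ)
    (hfa : ∀ x, ‖x‖ = a → θ * f a ≤ v x)
    (hode : ∀ r, a < r → r < b → 0 < f r →
      0 ≤ Lam * f'' r + lam * (n - 1) * (f' r / r) + W r * f r)
    (hW : ∀ x, a < ‖x‖ → ‖x‖ < b → W ‖x‖ < v x ^ (p - 1))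
    {x : EuclideanSpace ℝ (Fin n)} (hax : a ≤ ‖x‖) (hxb : ‖x‖ ≤ b) : θ * f ‖x‖ ≤ v x := by
  by_contra! hcon
  have hsub : {x : EuclideanSpace ℝ (Fin n) | a ≤ ‖x‖ ∧ ‖x‖ ≤ b} ⊆ ball 0 K := fun z hz => by
    simpa using hz.2.trans_lt hbK
  have hfc : ContinuousOn (fun z : EuclideanSpace ℝ (Fin n) => f ‖z‖) {x | a ≤ ‖x‖ ∧ ‖x‖ ≤ b} :=
    fun z hz => ((hf ‖z‖ (ha.trans_le hz.1)).continuousAt.comp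
      continuous_norm.continuousAt).continuousWithinAt
  obtain ⟨y, hy, hmax⟩ := (isCompact_closedAnnulus a b).exists_isMaxOn ⟨x, hax, hxb⟩
    (hfc.div (hv.contDiffOn.continuousOn.mono hsub) fun z hz => (hpos z hz.1 hz.2).ne')
  rw [isMaxOn_iff] at hmax
  have hvy := hpos y hy.1 hy.2
  have hvx := hpos x hax hxb
  have hyx : f ‖x‖ / v x ≤ f ‖y‖ / v y := hmax x ⟨hax, hxb⟩
  have h1 : 1 / θ < f ‖x‖ / v x := by
    rw [div_lt_div_iff₀ hθ hvx]; linarith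
  have h2 : v y < θ * f ‖y‖ := by
    have := h1.trans_le hyx
    rw [div_lt_div_iff₀ hθ hvy] at this
    linarith
  have hfy : 0 < f ‖y‖ := by
    by_contra! hneg
    nlinarith
  have hya : a < ‖y‖ := by
    refine lt_of_le_of_ne hy.1 fun he => ?_
    have := hfa y he.symm
    rw [← he] at h2
    linarith
  have hyb : ‖y‖ < b := by
    refine lt_of_le_of_ne hy.2 fun he => ?_
    rw [he] at hfy
    linarith
  have hy0 : 0 < ‖y‖ := ha.trans hya
  set τ := v y / f ‖y‖ with hτ
  have hτ0 : 0 < τ := div_pos hvy hfy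
  have hτy : τ * f ‖y‖ = v y := div_mul_cancel₀ _ hfy.ne'
  have := (hv.hasPucciValue y (hsub hy)).radial_le (f := fun r => τ * f r)
    (f' := fun r => τ * f' r) h0 h
    (hv.contDiffOn.contDiffAt (isOpen_ball.mem_nhds (hsub hy))) (norm_pos_iff.1 hy0)
    (by filter_upwards [lt_mem_nhds hy0] with ρ hρ using (hf ρ hρ).const_mul τ)
    ((hf' _ hy0).const_mul τ) (by
      filter_upwards [closedAnnulus_mem_nhds hya hyb] with z hz
      have h3 : f ‖z‖ / v z ≤ f ‖y‖ / v y := hmax z hz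
      rw [div_le_div_iff₀ (hpos z hz.1 hz.2) hvy] at h3
      have h4 : τ * f ‖z‖ ≤ v z := by
        rw [hτ, div_mul_eq_mul_div, div_le_iff₀ hfy]; linarith
      linarith)
  have h5 := hode _ hya hyb hfy
  have h6 := hW y hya hyb
  have h7 : v y ^ p = v y ^ (p - 1) * v y := by
    rw [← Real.rpow_add_one hvy.ne']; ring_nf
  have h8 : τ * (Lam * f'' ‖y‖ + lam * (n - 1) * (f' ‖y‖ / ‖y‖) + W ‖y‖ * f ‖y‖) =
      (Lam * (τ * f'' ‖y‖) + lam * (n - 1) * (τ * f' ‖y‖ / ‖y‖)) + W ‖y‖ * (τ * f ‖y‖) := by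
    ring
  have h9 := mul_nonneg hτ0.le h5
  rw [h8, hτy] at h9
  have h10 := mul_lt_mul_of_pos_right h6 hvy
  linarith

end Comparison

section LowerBounds

variable {n : ℕ} {lam Lam p α N K R M δ : ℝ}

/-- A solution bounded below near the origin decays at most like the fundamental solution. -/
lemma IsPucciSol.rpow_le (h0 : 0 < lam) (h : lam ≤ Lam) (hα : 0 < α) (hN0 : 0 ≤ N)
    (hN : N ≤ α + 1) (hlN : lam * ((n : ℝ) - 1) = Lam * N) (hM0 : 0 < M) (hM : M ^ (-α) = 1 / 4)
    {v : EuclideanSpace ℝ (Fin n) → ℝ} (hv : IsPucciSol lam Lam p v (ball 0 K)) (hδ : 0 < δ)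
    (hδR : δ ≤ R) (hRK : R < K) (hvδ : ∀ x, ‖x‖ ≤ δ → 1 / 2 ≤ v x)
    {x : EuclideanSpace ℝ (Fin n)} (hδx : δ ≤ ‖x‖) (hx : M * ‖x‖ ≤ R) (hxR : ‖x‖ ≤ R) :
    δ ^ α / 4 * ‖x‖ ^ (-α) ≤ v x := by
  have hLam : 0 < Lam := h0.trans_le h
  have hR : 0 < R := hδ.trans_le hδR
  have hx0 : 0 < ‖x‖ := hδ.trans_le hδx
  set B := R ^ (-α) with hB
  have hB0 : 0 < B := Real.rpow_pos_of_pos hR _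
  set A := δ ^ α / 2 with hA
  have hA0 : 0 < A := by positivity
  have hδα : A * δ ^ (-α) = 1 / 2 := by
    rw [hA, Real.rpow_neg hδ.le]
    field_simp
  have key := hv.radial_le (a := δ) (b := R) h0.le h hδ hRK
    (f := fun r => A * (r ^ (-α) - 2 * B + B / R ^ 2 * r ^ 2))
    (f' := fun r => A * (-α * r ^ (-α - 1) + B / R ^ 2 * (2 * r)))
    (f'' := fun r => A * (-α * ((-α - 1) * r ^ (-α - 1 - 1)) + B / R ^ 2 * 2))
    (fun r hr => by
      have h1 := Real.hasDerivAt_rpow_const (x := r) (p := -α) (Or.inl hr.ne')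
      have h2 := ((hasDerivAt_id r).pow 2).const_mul (B / R ^ 2)
      refine (((h1.sub_const (2 * B)).add h2).const_mul A).congr_deriv ?_
      simp)
    (fun r hr => by
      have h1 := (Real.hasDerivAt_rpow_const (x := r) (p := -α - 1) (Or.inl hr.ne')).const_mul (-α)
      have h2 := ((hasDerivAt_id r).const_mul 2).const_mul (B / R ^ 2)
      refine ((h1.add h2).const_mul A).congr_deriv ?_
      simp)
    (by
      have : B / R ^ 2 * R ^ 2 = B := by field_simp
      simp only [← hB, this]
      linarith)
    (fun z hz => by
      refine le_trans ?_ (hvδ z hz.le)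
      have : B / R ^ 2 * δ ^ 2 ≤ B := by
        rw [div_mul_eq_mul_div, div_le_iff₀ (by positivity)]
        gcongr
      nlinarith)
    (fun r hr _ => by
      have hr0 : 0 < r := hδ.trans hr
      have e1 : r ^ (-α - 1) = r ^ (-α - 1 - 1) * r := by
        rw [Real.rpow_sub_one hr0.ne' (-α - 1)]; field_simp
      set Y := r ^ (-α - 1 - 1) with hY
      have hY0 : 0 < Y := Real.rpow_pos_of_pos hr0 _
      rw [hlN, e1]
      have e2 : Lam * (A * (-α * ((-α - 1) * Y) + B / R ^ 2 * 2)) +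
          Lam * N * (A * (-α * (Y * r) + B / R ^ 2 * (2 * r)) / r) =
          Lam * A * (α * (α + 1 - N) * Y + B / R ^ 2 * (2 + 2 * N)) := by
        field_simp
        ring
      rw [e2]
      have : 0 ≤ α * (α + 1 - N) * Y :=
        mul_nonneg (mul_nonneg hα.le (by linarith)) hY0.le
      have : 0 < B / R ^ 2 * (2 + 2 * N) := by positivity
      positivity)
    hδx hxR
  refine le_trans ?_ key
  have h4 : 4 * B ≤ ‖x‖ ^ (-α) := by
    have : B ≤ (M * ‖x‖) ^ (-α) :=
      Real.rpow_le_rpow_of_nonpos (by positivity) hx (by linarith)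
    rw [Real.mul_rpow hM0.le hx0.le, hM] at this
    linarith
  have h5 : 0 ≤ B / R ^ 2 * ‖x‖ ^ 2 := by positivity
  rw [show δ ^ α / 4 = A / 2 by rw [hA]; ring]
  nlinarith

/-- The critical decay rate can be improved, since `v ^ (p - 1)` then dominates an inverse square
potential. -/
lemma IsPucciSol.improved_rpow_le (h0 : 0 < lam) (h : lam ≤ Lam) (hα : 0 < α) (hN : N ≤ α + 1)
    (hlN : lam * ((n : ℝ) - 1) = Lam * N) (hpα : α * (p - 1) = 2) (hM1 : 1 ≤ M)
    (hM : M ^ (-(α / 2)) = 1 / 2) {ε c : ℝ} (hε : 0 < ε) (hεα : ε ≤ α / 4) (hc : 0 < c)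
    (hεc : Lam * (ε * (α - ε)) < c ^ (p - 1))
    {v : EuclideanSpace ℝ (Fin n) → ℝ} (hv : IsPucciSol lam Lam p v (ball 0 K)) (hδ : 0 < δ)
    (hδR : δ ≤ R) (hRK : R < K) (hvδ : ∀ x, ‖x‖ ≤ δ → 1 / 2 ≤ v x)
    (hvc : ∀ x, δ ≤ ‖x‖ → ‖x‖ ≤ R → c * ‖x‖ ^ (-α) ≤ v x)
    {x : EuclideanSpace ℝ (Fin n)} (hδx : δ ≤ ‖x‖) (hx : M * ‖x‖ ≤ R) :
    δ ^ (α - ε) / 4 * ‖x‖ ^ (-(α - ε)) ≤ v x := by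
  have hLam : 0 < Lam := h0.trans_le h
  have hp : 0 < p - 1 := by
    by_contra! hneg
    nlinarith
  have hR : 0 < R := hδ.trans_le hδR
  have hx0 : 0 < ‖x‖ := hδ.trans_le hδx
  have hxR : ‖x‖ ≤ R := by nlinarith
  set B := R ^ (2 * ε - α) with hB
  have hB0 : 0 < B := Real.rpow_pos_of_pos hR _
  set A := δ ^ (α - ε) / 2 with hA
  have hA0 : 0 < A := by positivity
  have hδα : A * δ ^ (-(α - ε)) = 1 / 2 := by
    rw [hA, Real.rpow_neg hδ.le]
    field_simp
  have key := hv.mul_radial_le (a := δ) (b := R) (θ := A) h0.le h hδ hRK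
    (fun z h1 h2 => lt_of_lt_of_le
      (mul_pos hc (Real.rpow_pos_of_pos (hδ.trans_le h1) _)) (hvc z h1 h2))
    (f := fun r => r ^ (-(α - ε)) - B * r ^ (-ε))
    (f' := fun r => -(α - ε) * r ^ (-(α - ε) - 1) - B * (-ε * r ^ (-ε - 1)))
    (f'' := fun r => -(α - ε) * ((-(α - ε) - 1) * r ^ (-(α - ε) - 1 - 1)) -
      B * (-ε * ((-ε - 1) * r ^ (-ε - 1 - 1))))
    (W := fun r => Lam * (ε * (α - ε)) * r ^ (-2 : ℝ))
    (fun r hr => by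
      have h1 := Real.hasDerivAt_rpow_const (x := r) (p := -(α - ε)) (Or.inl hr.ne')
      have h2 := Real.hasDerivAt_rpow_const (x := r) (p := -ε) (Or.inl hr.ne')
      exact h1.sub (h2.const_mul B))
    (fun r hr => by
      have h1 := Real.hasDerivAt_rpow_const (x := r) (p := -(α - ε) - 1) (Or.inl hr.ne')
      have h2 := Real.hasDerivAt_rpow_const (x := r) (p := -ε - 1) (Or.inl hr.ne')
      exact (h1.const_mul _).sub ((h2.const_mul _).const_mul B))
    (by
      rw [hB, ← Real.rpow_add hR]
      ring_nf
      exact le_rfl)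
    hA0
    (fun z hz => by
      refine le_trans ?_ (hvδ z hz.le)
      have : 0 ≤ A * (B * δ ^ (-ε)) := by positivity
      nlinarith)
    (fun r hr _ hfr => by
      have hr0 : 0 < r := hδ.trans hr
      set X := r ^ (-(α - ε)) with hX
      set Y := r ^ (-ε) with hY
      have hX0 : 0 < X := Real.rpow_pos_of_pos hr0 _
      have hY0 : 0 < Y := Real.rpow_pos_of_pos hr0 _
      rw [hlN, Real.rpow_sub_one hr0.ne' (-(α - ε) - 1), Real.rpow_sub_one hr0.ne' (-(α - ε)),
        Real.rpow_sub_one hr0.ne' (-ε - 1), Real.rpow_sub_one hr0.ne' (-ε),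
        Real.rpow_neg hr0.le 2, Real.rpow_two, ← hX, ← hY]
      have e2 : Lam * (-(α - ε) * ((-(α - ε) - 1) * (X / r / r)) -
            B * (-ε * ((-ε - 1) * (Y / r / r)))) +
          Lam * N * ((-(α - ε) * (X / r) - B * (-ε * (Y / r))) / r) +
          Lam * (ε * (α - ε)) * (r ^ 2)⁻¹ * (X - B * Y) =
          Lam / r ^ 2 * ((α + 1 - N) * ((α - ε) * X - ε * (B * Y))) := by
        field_simp
        ring
      rw [e2]
      have hBY : 0 < B * Y := by positivity
      have : 0 ≤ (α - ε) * X - ε * (B * Y) := by nlinarith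
      have : 0 ≤ α + 1 - N := by linarith
      positivity)
    (fun z h1 h2 => by
      have hz0 : 0 < ‖z‖ := hδ.trans h1
      have h3 : (c * ‖z‖ ^ (-α)) ^ (p - 1) ≤ v z ^ (p - 1) :=
        Real.rpow_le_rpow (by positivity) (hvc z h1.le h2.le) hp.le
      refine lt_of_lt_of_le ?_ h3
      rw [Real.mul_rpow hc.le (by positivity), ← Real.rpow_mul hz0.le,
        show -α * (p - 1) = -2 by linarith]
      exact mul_lt_mul_of_pos_right hεc (Real.rpow_pos_of_pos hz0 _))
    hδx hxR
  refine le_trans ?_ key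
  have h4 : B * ‖x‖ ^ (-ε) ≤ 1 / 2 * ‖x‖ ^ (-(α - ε)) := by
    have h5 : B ≤ (M * ‖x‖) ^ (2 * ε - α) :=
      Real.rpow_le_rpow_of_nonpos (by positivity) hx (by linarith)
    have h6 : M ^ (2 * ε - α) ≤ 1 / 2 := by
      rw [← hM]
      exact Real.rpow_le_rpow_of_exponent_le hM1 (by linarith)
    rw [Real.mul_rpow (by linarith) hx0.le] at h5
    calc B * ‖x‖ ^ (-ε) ≤ (1 / 2 * ‖x‖ ^ (2 * ε - α)) * ‖x‖ ^ (-ε) := by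
          gcongr
          exact h5.trans (by gcongr)
      _ = _ := by
          rw [mul_assoc, ← Real.rpow_add hx0]
          ring_nf
  rw [show δ ^ (α - ε) / 4 = A / 2 by rw [hA]; ring]
  nlinarith

/-- A large potential on an annulus is incompatible with positivity. -/
lemma IsPucciSol.false_of_large_potential (h0 : 0 < lam) (h : lam ≤ Lam) (hn : 1 ≤ n)
    (hN0 : 0 ≤ N) (hlN : lam * ((n : ℝ) - 1) = Lam * N)
    {v : EuclideanSpace ℝ (Fin n) → ℝ} (hv : IsPucciSol lam Lam p v (ball 0 K)) {a : ℝ}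
    (ha : 0 < a) (haK : 2 * a < K) (hpos : ∀ x, a ≤ ‖x‖ → ‖x‖ ≤ 2 * a → 0 < v x)
    (hW : ∀ x, a < ‖x‖ → ‖x‖ < 2 * a →
      Lam * ((12 + 2 * N) ^ 2 / 8) / a ^ 2 < v x ^ (p - 1)) : False := by
  have hLam : 0 < Lam := h0.trans_le h
  set x : EuclideanSpace ℝ (Fin n) := EuclideanSpace.single ⟨0, hn⟩ (3 / 2 * a) with hx
  have hxn : ‖x‖ = 3 / 2 * a := by
    simp [hx, abs_of_pos ha]
  have hvx := hpos x (by rw [hxn]; linarith) (by rw [hxn]; linarith)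
  have key := hv.mul_radial_le (a := a) (b := 2 * a) (θ := 32 * v x / a ^ 4) h0.le h ha haK hpos
    (f := fun r => ((r - a) * (2 * a - r)) ^ 2)
    (f' := fun r => 2 * ((r - a) * (2 * a - r)) * (3 * a - 2 * r))
    (f'' := fun r => 2 * (3 * a - 2 * r) ^ 2 - 4 * ((r - a) * (2 * a - r)))
    (W := fun _ => Lam * ((12 + 2 * N) ^ 2 / 8) / a ^ 2)
    (fun r hr => by
      have := (((hasDerivAt_id r).sub_const a).mul ((hasDerivAt_id r).const_sub (2 * a))).pow 2
      refine this.congr_deriv ?_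
      simp
      left
      ring)
    (fun r hr => by
      have h1 := ((hasDerivAt_id r).sub_const a).mul ((hasDerivAt_id r).const_sub (2 * a))
      have := (h1.const_mul 2).mul (((hasDerivAt_id r).const_mul 2).const_sub (3 * a))
      refine this.congr_deriv ?_
      simp
      ring)
    (by simp) (by positivity)
    (fun z hz => by simpa using (hpos z hz.ge (by linarith)).le)
    (fun r h1 h2 _ => by
      have hr0 : 0 < r := ha.trans h1
      set q := (r - a) * (2 * a - r) with hq
      have hq0 : 0 < q := mul_pos (by linarith) (by linarith)
      have hd : (3 * a - 2 * r) ^ 2 = a ^ 2 - 4 * q := by rw [hq]; ring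
      have h3 : -1 ≤ (3 * a - 2 * r) / r := by
        rw [le_div_iff₀ hr0]; linarith
      have h4 : -(2 * q * N) ≤ 2 * q * N * ((3 * a - 2 * r) / r) := by
        nlinarith [mul_nonneg hq0.le hN0]
      have e : Lam * (2 * (3 * a - 2 * r) ^ 2 - 4 * q) +
          lam * ((n : ℝ) - 1) * (2 * q * (3 * a - 2 * r) / r) +
          Lam * ((12 + 2 * N) ^ 2 / 8) / a ^ 2 * q ^ 2 =
          Lam * (2 * (a ^ 2 - 4 * q) - 4 * q + 2 * q * N * ((3 * a - 2 * r) / r) +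
            (12 + 2 * N) ^ 2 / 8 / a ^ 2 * q ^ 2) := by
        rw [hlN, hd]
        field_simp
      rw [e]
      refine mul_nonneg hLam.le ?_
      have h5 : 2 * a ^ 2 - (12 + 2 * N) * q + (12 + 2 * N) ^ 2 / 8 / a ^ 2 * q ^ 2 =
          2 * (a - (12 + 2 * N) * q / (4 * a)) ^ 2 := by
        field_simp
        ring
      nlinarith [sq_nonneg (a - (12 + 2 * N) * q / (4 * a))])
    hW (x := x) (by rw [hxn]; linarith) (by rw [hxn]; linarith)
  simp only [hxn] at key
  have : 32 * v x / a ^ 4 * ((3 / 2 * a - a) * (2 * a - 3 / 2 * a)) ^ 2 = 2 * v x := by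
    field_simp
    ring
  linarith

end LowerBounds

section Universal

variable {n : ℕ} {lam Lam p α N : ℝ}

/-- Quantitative Liouville property: a solution bounded below near the origin lives in a ball of
bounded radius. -/
lemma exists_radius_le (h0 : 0 < lam) (h : lam ≤ Lam) (hn : 1 ≤ n) (hα : 0 < α) (hN0 : 0 ≤ N)
    (hN : N ≤ α + 1) (hlN : lam * ((n : ℝ) - 1) = Lam * N) (hpα : α * (p - 1) = 2) {δ : ℝ}
    (hδ : 0 < δ) (hδ1 : δ ≤ 1) :
    ∃ K₀ : ℝ, ∀ (K : ℝ) (v : EuclideanSpace ℝ (Fin n) → ℝ), IsPucciSol lam Lam p v (ball 0 K) →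
      (∀ x, ‖x‖ ≤ δ → 1 / 2 ≤ v x) → K ≤ K₀ := by
  have hLam : 0 < Lam := h0.trans_le h
  have hp : 0 < p - 1 := by
    by_contra! hneg
    nlinarith
  set M : ℝ := 4 ^ (1 / α) with hM
  have hM1 : 1 ≤ M := Real.one_le_rpow (by norm_num) (by positivity)
  have hM0 : 0 < M := by linarith
  have hMα : M ^ (-α) = 1 / 4 := by
    rw [hM, ← Real.rpow_mul (by norm_num), show 1 / α * -α = -1 by field_simp, Real.rpow_neg_one]
    norm_num
  have hMα2 : M ^ (-(α / 2)) = 1 / 2 := by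
    rw [hM, ← Real.rpow_mul (by norm_num), show 1 / α * -(α / 2) = -(1 / 2) by field_simp,
      Real.rpow_neg (by norm_num), ← Real.sqrt_eq_rpow, show (4 : ℝ) = 2 ^ 2 by norm_num,
      Real.sqrt_sq (by norm_num)]
    norm_num
  set c₁ := δ ^ α / 4 with hc₁
  have hc₁0 : 0 < c₁ := by positivity
  set ε := min (α / 4) (c₁ ^ (p - 1) / (2 * α * Lam)) with hε
  have hε0 : 0 < ε := lt_min (by positivity) (by positivity)
  have hεα : ε ≤ α / 4 := min_le_left _ _
  have hεc : Lam * (ε * (α - ε)) < c₁ ^ (p - 1) := by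
    have h1 : ε ≤ c₁ ^ (p - 1) / (2 * α * Lam) := min_le_right _ _
    rw [le_div_iff₀ (by positivity)] at h1
    have h2 : 0 < c₁ ^ (p - 1) := by positivity
    nlinarith [mul_pos hLam (mul_pos hε0 hε0)]
  set c₂ := δ ^ (α - ε) / 4 with hc₂
  have hc₂0 : 0 < c₂ := by positivity
  set w := (12 + 2 * N) ^ 2 / 8 with hw
  have hw0 : 0 < w := by positivity
  set κ := ε * (p - 1) with hκ
  have hκ0 : 0 < κ := mul_pos hε0 hp
  have hκ2 : κ < 2 := by nlinarith
  set T := (4 * Lam * w / c₂ ^ (p - 1)) ^ (1 / κ) with hT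
  have hT0 : 0 < T := by positivity
  refine ⟨2 * M ^ 2 * max 2 T, fun K v hv hvδ => ?_⟩
  by_contra! hK
  set a := K / (4 * M ^ 2) with ha
  have hKa : K = 4 * M ^ 2 * a := by rw [ha]; field_simp
  clear_value a M c₁ c₂ ε w
  have h2a : max 2 T < 2 * a := by
    rw [hKa, show 4 * M ^ 2 * a = 2 * M ^ 2 * (2 * a) by ring] at hK
    exact lt_of_mul_lt_mul_left hK (by positivity)
  have ha1 : 1 < a := by linarith [le_max_left 2 T]
  have haT : T < 2 * a := (le_max_right _ _).trans_lt h2a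
  have ha0 : 0 < a := by linarith
  have hMM : M ≤ M ^ 2 := by nlinarith
  have hMa : a ≤ M * a := by nlinarith
  have hMMa : M * a ≤ M ^ 2 * a := by gcongr
  have hK1 : 2 * (M ^ 2 * a) < K := by rw [hKa]; linarith
  have hK2 : 2 * (M * a) < K := by linarith
  have hv₁ : ∀ x, δ ≤ ‖x‖ → ‖x‖ ≤ 2 * (M * a) → c₁ * ‖x‖ ^ (-α) ≤ v x := by
    intro x hx1 hx2
    rw [hc₁]
    exact hv.rpow_le h0 h hα hN0 hN hlN hM0 hMα hδ (R := 2 * (M ^ 2 * a)) (by linarith)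
      hK1 hvδ hx1 ((mul_le_mul_of_nonneg_left hx2 hM0.le).trans_eq (by ring)) (by linarith)
  have hv₂ : ∀ x, δ ≤ ‖x‖ → ‖x‖ ≤ 2 * a → c₂ * ‖x‖ ^ (-(α - ε)) ≤ v x := by
    intro x hx1 hx2
    rw [hc₂]
    exact hv.improved_rpow_le h0 h hα hN hlN hpα hM1 hMα2 hε0 hεα hc₁0 hεc hδ
      (R := 2 * (M * a)) (by linarith) hK2 hvδ hv₁ hx1
      ((mul_le_mul_of_nonneg_left hx2 hM0.le).trans_eq (by ring))
  refine hv.false_of_large_potential h0 h hn hN0 hlN ha0 (by rw [hKa]; linarith)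
    (fun x hx1 hx2 => lt_of_lt_of_le
      (mul_pos hc₂0 (Real.rpow_pos_of_pos (ha0.trans_le hx1) _)) (hv₂ x (by linarith) hx2))
    fun x hx1 hx2 => ?_
  have hx0 : 0 < ‖x‖ := ha0.trans hx1
  have h3 : (c₂ * ‖x‖ ^ (-(α - ε))) ^ (p - 1) ≤ v x ^ (p - 1) :=
    Real.rpow_le_rpow (by positivity) (hv₂ x (by linarith) hx2.le) hp.le
  refine lt_of_lt_of_le ?_ h3
  rw [Real.mul_rpow hc₂0.le (by positivity), ← Real.rpow_mul hx0.le,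
    show -(α - ε) * (p - 1) = κ - 2 by rw [hκ]; linarith]
  have h4 : (2 * a) ^ (κ - 2) ≤ ‖x‖ ^ (κ - 2) :=
    Real.rpow_le_rpow_of_nonpos hx0 hx2.le (by linarith)
  have h5 : 4 * Lam * w / c₂ ^ (p - 1) < (2 * a) ^ κ := by
    have := Real.rpow_lt_rpow hT0.le haT hκ0
    rwa [hT, ← Real.rpow_mul (by positivity), one_div_mul_cancel hκ0.ne', Real.rpow_one] at this
  rw [div_lt_iff₀ (by positivity)] at h5
  have h6 : (2 * a) ^ (κ - 2) = (2 * a) ^ κ / (2 * a) ^ 2 := by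
    rw [Real.rpow_sub (by positivity), Real.rpow_two]
  rw [← hw]
  calc Lam * w / a ^ 2 = 4 * Lam * w / (2 * a) ^ 2 := by field_simp; norm_num
    _ < (2 * a) ^ κ * c₂ ^ (p - 1) / (2 * a) ^ 2 := by gcongr
    _ = c₂ ^ (p - 1) * (2 * a) ^ (κ - 2) := by rw [h6]; ring
    _ ≤ _ := by gcongr

/-- Lipschitz estimate for bounded solutions. -/
lemma exists_lipschitz_bound (n : ℕ) (p : ℝ) (h0 : 0 < lam) (h : lam ≤ Lam) (hp : 0 < p) {A : ℝ}
    (hA : 0 < A) :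
    ∃ C : ℝ, 0 < C ∧ ∀ u : EuclideanSpace ℝ (Fin n) → ℝ, IsPucciSol lam Lam p u (ball 0 2) →
      (∀ x ∈ ball 0 2, u x ≤ A) → ∀ x, ‖x‖ ≤ 1 → |u x - u 0| ≤ C * ‖x‖ := by
  have hLam : 0 < Lam := h0.trans_le h
  set L := (4 * n * Lam * A + 2 * A ^ p) / lam + 1 with hL
  have hL0 : 0 < L := by positivity
  have hLlam : 4 * n * Lam * A + 2 * A ^ p < lam * L := by
    rw [hL, mul_add, mul_div_cancel₀ _ h0.ne']
    linarith
  refine ⟨L + A, by positivity, fun u hu huA x hx => ?_⟩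
  have hF : ∀ x ∈ ball 0 2, |(-(u x) ^ p)| ≤ A ^ p := fun x hx => by
    rw [abs_neg, abs_of_nonneg (Real.rpow_nonneg (hu.nonneg x hx) _)]
    exact Real.rpow_le_rpow (hu.nonneg x hx) (huA x hx) hp.le
  have hx' : x ∈ closedBall (0 : EuclideanSpace ℝ (Fin n)) 1 := by simpa using hx
  have h0' : (0 : EuclideanSpace ℝ (Fin n)) ∈ closedBall (0 : EuclideanSpace ℝ (Fin n)) 1 := by
    simp
  have h1 := sub_le_of_hasPucciValue h0 h hu.contDiffOn hu.nonneg huA hu.hasPucciValue hF hLlam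
    hx' h0'
  have h2 := sub_le_of_hasPucciValue h0 h hu.contDiffOn hu.nonneg huA hu.hasPucciValue hF hLlam
    h0' hx'
  simp only [sub_zero, zero_sub, norm_neg, norm_zero] at h1 h2
  have h3 : A * ‖x‖ ^ 2 ≤ A * ‖x‖ := by
    gcongr
    nlinarith [norm_nonneg x]
  rw [abs_le]
  constructor <;> nlinarith

lemma IsPucciSol.mono {u : EuclideanSpace ℝ (Fin n) → ℝ} {U V : Set (EuclideanSpace ℝ (Fin n))}
    (hu : IsPucciSol lam Lam p u U) (hVU : V ⊆ U) : IsPucciSol lam Lam p u V :=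
  ⟨hu.contDiffOn.mono hVU, fun x hx => hu.nonneg x (hVU hx),
    fun x hx => hu.hasPucciValue x (hVU hx)⟩

lemma IsPucciSol.rescale (hpα : α * (p - 1) = 2) {u : EuclideanSpace ℝ (Fin n) → ℝ}
    {U V : Set (EuclideanSpace ℝ (Fin n))} (hu : IsPucciSol lam Lam p u U) (hU : IsOpen U)
    {y : EuclideanSpace ℝ (Fin n)} {a : ℝ} (ha : 0 < a) (hmap : ∀ z ∈ V, y + a • z ∈ U) :
    IsPucciSol lam Lam p (fun z => a ^ α * u (y + a • z)) V := by
  have haα : 0 < a ^ α := Real.rpow_pos_of_pos ha _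
  refine ⟨?_, fun z hz => mul_nonneg haα.le (hu.nonneg _ (hmap z hz)), fun z hz => ?_⟩
  · refine contDiffOn_const.mul (hu.contDiffOn.comp (f := fun z => y + a • z) ?_ hmap)
    fun_prop
  · have h1 := (hu.hasPucciValue _ (hmap z hz)).const_mul (c := a ^ α * a ^ 2) (by positivity)
    have h2 : secondDeriv (fun z => a ^ α * u (y + a • z)) z =
        fun ξ => a ^ α * a ^ 2 * secondDeriv u (y + a • z) ξ := by
      ext ξ
      exact secondDeriv_rescale _ (hu.contDiffOn.contDiffAt (hU.mem_nhds (hmap z hz))) ξ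
    have h3 : -(a ^ α * u (y + a • z)) ^ p = a ^ α * a ^ 2 * -(u (y + a • z)) ^ p := by
      rw [Real.mul_rpow haα.le (hu.nonneg _ (hmap z hz)), ← Real.rpow_mul ha.le,
        show α * p = α + 2 by linarith, Real.rpow_add ha, Real.rpow_two]
      ring
    rw [h2, h3]
    exact h1

/-- Quantitative Liouville theorem for normalized solutions. -/
lemma exists_radius_le_of_normalized (h0 : 0 < lam) (h : lam ≤ Lam) (hn : 1 ≤ n) (hα : 0 < α)
    (hN0 : 0 ≤ N) (hN : N ≤ α + 1) (hlN : lam * ((n : ℝ) - 1) = Lam * N)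
    (hpα : α * (p - 1) = 2) :
    ∃ K₀ : ℝ, 0 < K₀ ∧ ∀ (K : ℝ) (v : EuclideanSpace ℝ (Fin n) → ℝ),
      IsPucciSol lam Lam p v (ball 0 K) → v 0 = 1 → (∀ x ∈ ball 0 K, v x ≤ 2 ^ α) → K ≤ K₀ := by
  have hp : 0 < p - 1 := by
    by_contra! hneg
    nlinarith
  obtain ⟨C, hC, hlip⟩ := exists_lipschitz_bound (lam := lam) (Lam := Lam) n p h0 h (by linarith)
    (A := 2 ^ α) (by positivity)
  set δ := min 1 (1 / (2 * C)) with hδ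
  have hδ0 : 0 < δ := lt_min one_pos (by positivity)
  have hδ1 : δ ≤ 1 := min_le_left _ _
  have hδC : C * δ ≤ 1 / 2 := by
    have : δ ≤ 1 / (2 * C) := min_le_right _ _
    rw [le_div_iff₀ (by positivity)] at this
    linarith
  obtain ⟨K₀, hK₀⟩ := exists_radius_le h0 h hn hα hN0 hN hlN hpα hδ0 hδ1
  refine ⟨max 2 K₀, by positivity, fun K v hv hv0 hv2 => ?_⟩
  rcases le_total K 2 with hK | hK
  · exact hK.trans (le_max_left _ _)
  refine (hK₀ K v hv fun x hx => ?_).trans (le_max_right _ _)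
  have hsub : ball (0 : EuclideanSpace ℝ (Fin n)) 2 ⊆ ball 0 K := ball_subset_ball hK
  have h1 := hlip v (hv.mono hsub) (fun x hx => hv2 x (hsub hx)) x (hx.trans hδ1)
  have h2 : C * ‖x‖ ≤ C * δ := by gcongr
  rw [hv0] at h1
  linarith [(abs_le.1 h1).1]

/-- Universal bound at the centre of the unit ball. -/
lemma exists_bound_center (h0 : 0 < lam) (h : lam ≤ Lam) (hn : 1 ≤ n) (hα : 0 < α)
    (hN0 : 0 ≤ N) (hN : N ≤ α + 1) (hlN : lam * ((n : ℝ) - 1) = Lam * N)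
    (hpα : α * (p - 1) = 2) :
    ∃ C : ℝ, 0 < C ∧ ∀ u : EuclideanSpace ℝ (Fin n) → ℝ,
      IsPucciSol lam Lam p u (ball 0 1) → u 0 ≤ C := by
  obtain ⟨K₀, hK₀, hK⟩ := exists_radius_le_of_normalized h0 h hn hα hN0 hN hlN hpα
  refine ⟨(4 * K₀) ^ α, by positivity, fun u hu => ?_⟩
  have hsub : closedBall (0 : EuclideanSpace ℝ (Fin n)) (1 / 2) ⊆ ball 0 1 :=
    closedBall_subset_ball (by norm_num)
  rcases (hu.nonneg 0 (by simp)).eq_or_lt with hz | hz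
  · rw [← hz]; positivity
  have hcont : ContinuousOn (fun x : EuclideanSpace ℝ (Fin n) => u x * (1 / 2 - ‖x‖) ^ α)
      (closedBall 0 (1 / 2)) := by
    refine (hu.contDiffOn.continuousOn.mono hsub).mul ?_
    refine Continuous.continuousOn (Continuous.rpow_const (by fun_prop) fun x => Or.inr hα.le)
  obtain ⟨y, hy, hmax⟩ := (isCompact_closedBall _ _).exists_isMaxOn ⟨0, by simp⟩ hcont
  rw [isMaxOn_iff] at hmax
  have hyn : ‖y‖ ≤ 1 / 2 := by simpa using hy
  have hy0 : u 0 * (1 / 2) ^ α ≤ u y * (1 / 2 - ‖y‖) ^ α := by simpa using hmax 0 (by simp)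
  have hpos : 0 < u y * (1 / 2 - ‖y‖) ^ α := lt_of_lt_of_le (by positivity) hy0
  have hy1 : ‖y‖ < 1 / 2 := by
    refine lt_of_le_of_ne hyn fun he => ?_
    rw [he, sub_self, Real.zero_rpow hα.ne', mul_zero] at hpos
    exact lt_irrefl _ hpos
  have huy : 0 < u y := by
    by_contra! hneg
    have := Real.rpow_nonneg (sub_nonneg.2 hyn) α
    nlinarith
  set ρ := (1 / 2 - ‖y‖) / 2 with hρ
  have hρ0 : 0 < ρ := by rw [hρ]; linarith
  have h2ρ : 1 / 2 - ‖y‖ = 2 * ρ := by rw [hρ]; ring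
  have hball : ∀ x, ‖x - y‖ < ρ → u x ≤ 2 ^ α * u y := by
    intro x hx
    have h1 : ‖x‖ ≤ ‖y‖ + ‖x - y‖ := by
      have := norm_add_le y (x - y)
      simpa using this
    have h2 := hmax x (by simp only [mem_closedBall, dist_zero_right]; linarith)
    have h3 : u x * ρ ^ α ≤ u y * (2 * ρ) ^ α := by
      rw [← h2ρ]
      refine le_trans ?_ h2
      have hux : 0 ≤ u x := hu.nonneg x (by simp only [mem_ball, dist_zero_right]; linarith)
      gcongr
      linarith
    rw [Real.mul_rpow (by norm_num) hρ0.le] at h3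
    have h4 : 0 < ρ ^ α := by positivity
    nlinarith
  set a := u y ^ (-(1 / α)) with ha
  have ha0 : 0 < a := by positivity
  have haα : a ^ α * u y = 1 := by
    rw [ha, ← Real.rpow_mul huy.le, show -(1 / α) * α = -1 by field_simp, Real.rpow_neg_one,
      inv_mul_cancel₀ huy.ne']
  have hdist : ∀ z ∈ ball (0 : EuclideanSpace ℝ (Fin n)) (ρ / a), ‖y + a • z - y‖ < ρ := by
    intro z hz
    rw [mem_ball, dist_zero_right, lt_div_iff₀ ha0] at hz
    rw [add_sub_cancel_left, norm_smul, Real.norm_of_nonneg ha0.le]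
    linarith
  have hw := hK (ρ / a) _ (hu.rescale hpα isOpen_ball (y := y) ha0 (V := ball 0 (ρ / a))
    fun z hz => by
      have h1 := hdist z hz
      have h2 := norm_add_le y (y + a • z - y)
      rw [add_sub_cancel] at h2
      simp only [mem_ball, dist_zero_right]
      linarith) (by simpa using haα) fun z hz => by
      have h1 := hball _ (hdist z hz)
      have : a ^ α * (2 ^ α * u y) = 2 ^ α := by rw [mul_left_comm, haα, mul_one]
      rw [← this]
      gcongr
  rw [div_le_iff₀ ha0] at hw
  have h1 : ρ ^ α * u y ≤ K₀ ^ α := by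
    calc ρ ^ α * u y ≤ (K₀ * a) ^ α * u y := by gcongr
      _ = K₀ ^ α := by rw [Real.mul_rpow hK₀.le ha0.le, mul_assoc, haα, mul_one]
  rw [h2ρ, Real.mul_rpow (by norm_num) hρ0.le] at hy0
  have h2 : (1 / 2 : ℝ) ^ α * 2 ^ α = 1 := by
    rw [← Real.mul_rpow (by norm_num) (by norm_num)]; norm_num
  have h3 : (4 * K₀) ^ α = 2 ^ α * (2 ^ α * K₀ ^ α) := by
    rw [← Real.mul_rpow (by norm_num) hK₀.le, ← Real.mul_rpow (by norm_num) (by positivity)]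
    ring_nf
  calc u 0 = u 0 * (1 / 2) ^ α * 2 ^ α := by rw [mul_assoc, h2, mul_one]
    _ ≤ u y * (2 ^ α * ρ ^ α) * 2 ^ α := by gcongr
    _ = 2 ^ α * (2 ^ α * (ρ ^ α * u y)) := by ring
    _ ≤ _ := by rw [h3]; gcongr

/-- Universal bound for the solution and its gradient at the centre of a ball of radius four. -/
lemma exists_bound_fderiv_center (h0 : 0 < lam) (h : lam ≤ Lam) (hn : 1 ≤ n) (hα : 0 < α)
    (hN0 : 0 ≤ N) (hN : N ≤ α + 1) (hlN : lam * ((n : ℝ) - 1) = Lam * N)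
    (hpα : α * (p - 1) = 2) :
    ∃ C : ℝ, 0 < C ∧ ∀ u : EuclideanSpace ℝ (Fin n) → ℝ,
      IsPucciSol lam Lam p u (ball 0 4) → u 0 ≤ C ∧ ‖fderiv ℝ u 0‖ ≤ C := by
  have hp : 0 < p - 1 := by
    by_contra! hneg
    nlinarith
  obtain ⟨C₁, hC₁, hb⟩ := exists_bound_center h0 h hn hα hN0 hN hlN hpα
  obtain ⟨C₂, hC₂, hlip⟩ := exists_lipschitz_bound (lam := lam) (Lam := Lam) n p h0 h (by linarith)
    hC₁
  refine ⟨max C₁ C₂, by positivity, fun u hu => ?_⟩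
  have hle : ∀ x ∈ ball 0 2, u x ≤ C₁ := by
    intro x hx
    have := hb _ (hu.rescale hpα isOpen_ball (y := x) one_pos (V := ball 0 1) fun z hz => by
      have := norm_add_le x z
      simp only [mem_ball, dist_zero_right, one_smul] at *
      linarith)
    simpa using this
  refine ⟨(hle 0 (by simp)).trans (le_max_left _ _), le_trans ?_ (le_max_right C₁ C₂)⟩
  refine norm_fderiv_le_of_lip' ℝ hC₂.le ?_
  filter_upwards [closedBall_mem_nhds (0 : EuclideanSpace ℝ (Fin n)) one_pos] with x hx
  simpa using hlip u (hu.mono (ball_subset_ball (by norm_num))) hle x (by simpa using hx)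

end Universal

lemma IsOpen.ball_infDist_frontier_subset {E : Type*} [NormedAddCommGroup E] [NormedSpace ℝ E]
    {U : Set E} (hU : IsOpen U) {x : E} (hx : x ∈ U) : ball x (infDist x (frontier U)) ⊆ U := by
  rcases le_or_gt (infDist x (frontier U)) 0 with hd | hd
  · rw [ball_eq_empty.2 hd]
    exact empty_subset _
  refine (convex_ball _ _).isPreconnected.subset_of_closure_inter_subset hU
    ⟨x, mem_ball_self hd, hx⟩ fun y hy => ?_
  by_contra hyU
  have hyf : y ∈ frontier U := by
    rw [hU.frontier_eq]
    exact ⟨hy.1, hyU⟩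
  have h1 := infDist_le_dist_of_mem (x := x) hyf
  have h2 := mem_ball'.1 hy.2
  linarith

theorem stmt6 (n : ℕ) (hn : 3 ≤ n) (lam Lam : ℝ) (hlam : 0 < lam) (hLam : lam ≤ Lam)
    (nt : ℝ) (hnt : nt = lam / Lam * ((n : ℝ) - 1) + 1)
    (p : ℝ) (hp : 1 < p)
    (hcrit : 2 < nt → p ≤ nt / (nt - 2)) :
    ∃ C : ℝ, 0 < C ∧
      ∀ Ω : Set (EuclideanSpace ℝ (Fin n)), IsOpen Ω → IsConnected Ω → Ω ≠ Set.univ →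
        ∀ u : EuclideanSpace ℝ (Fin n) → ℝ, ContDiffOn ℝ 2 u Ω →
          (∀ x ∈ Ω, 0 ≤ u x) →
          (∀ x ∈ Ω, pucciMax lam Lam (hess u x) + u x ^ p = 0) →
          ∀ x ∈ Ω, u x + ‖gradient u x‖ ^ (2 / (p + 1)) ≤
            C * Metric.infDist x (frontier Ω) ^ (-(2 / (p - 1))) := by
  have hLam0 : 0 < Lam := hlam.trans_le hLam
  have hn1 : (1 : ℝ) ≤ n := by exact_mod_cast (by omega : 1 ≤ n)
  have hp1 : 0 < p - 1 := by linarith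
  set α := 2 / (p - 1) with hα
  have hα0 : 0 < α := by positivity
  have hpα : α * (p - 1) = 2 := by rw [hα]; field_simp
  set N := lam / Lam * ((n : ℝ) - 1) with hN
  have hN0 : 0 ≤ N := mul_nonneg (by positivity) (by linarith)
  have hlN : lam * ((n : ℝ) - 1) = Lam * N := by rw [hN]; field_simp
  have hNα : N ≤ α + 1 := by
    rcases le_or_gt nt 2 with h2 | h2
    · linarith
    · have h3 := hcrit h2
      rw [le_div_iff₀ (by linarith)] at h3
      have h4 : (p - 1) * (nt - 2) ≤ α * (p - 1) := by linarith
      have h5 : nt - 2 ≤ α := by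
        by_contra! hlt
        nlinarith
      linarith
  obtain ⟨C, hC, hbound⟩ :=
    exists_bound_fderiv_center hlam hLam (by omega) hα0 hN0 hNα hlN hpα
  refine ⟨4 ^ α * (C + C ^ (2 / (p + 1))), by positivity,
    fun Ω hΩ hΩc hΩu u hu hu0 hueq x hx => ?_⟩
  have hsol : IsPucciSol lam Lam p u Ω := by
    refine ⟨hu, hu0, fun z hz => ?_⟩
    rw [← eq_neg_of_add_eq_zero_left (hueq z hz)]
    exact hasPucciValue_hess hLam (hu.contDiffAt (hΩ.mem_nhds hz))
  set d := infDist x (frontier Ω) with hd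
  have hne : (frontier Ω).Nonempty := nonempty_frontier_iff.2 ⟨⟨x, hx⟩, hΩu⟩
  have hd0 : 0 < d := by
    refine (isClosed_frontier.notMem_iff_infDist_pos hne).1 fun hxf => ?_
    rw [hΩ.frontier_eq] at hxf
    exact hxf.2 hx
  set a := d / 4 with ha
  have ha0 : 0 < a := by positivity
  have hsub := hΩ.ball_infDist_frontier_subset hx
  obtain ⟨h1, h2⟩ := hbound _ (hsol.rescale hpα hΩ (y := x) ha0 (V := ball 0 4) fun z hz => by
    refine hsub ?_
    rw [mem_ball, dist_eq_norm, add_sub_cancel_left, norm_smul, Real.norm_of_nonneg ha0.le, ← hd]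
    rw [mem_ball, dist_zero_right] at hz
    have : d = a * 4 := by rw [ha]; ring
    rw [this]
    gcongr)
  have hux : DifferentiableAt ℝ u (x + a • (0 : EuclideanSpace ℝ (Fin n))) := by
    simpa using (hu.contDiffAt (hΩ.mem_nhds hx)).differentiableAt (by simp)
  have hfd : fderiv ℝ (fun z => a ^ α * u (x + a • z)) 0 = (a ^ α * a) • fderiv ℝ u x := by
    have hl : HasFDerivAt (fun z : EuclideanSpace ℝ (Fin n) => x + a • z)
        (a • ContinuousLinearMap.id ℝ (EuclideanSpace ℝ (Fin n))) 0 :=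
      ((hasFDerivAt_id _).const_smul a).const_add x
    have := (hux.hasFDerivAt.comp (0 : EuclideanSpace ℝ (Fin n)) hl).const_mul (a ^ α)
    refine this.fderiv.trans ?_
    ext ξ
    simp
    ring
  have haα : 0 < a ^ α := by positivity
  rw [hfd, norm_smul, Real.norm_of_nonneg (by positivity)] at h2
  simp only [smul_zero, add_zero] at h1
  have hgrad : ‖gradient u x‖ = ‖fderiv ℝ u x‖ := by simp [gradient]
  have hda : 4 ^ α * d ^ (-α) = a ^ (-α) := by
    rw [ha, Real.div_rpow hd0.le (by norm_num), Real.rpow_neg (by norm_num : (0 : ℝ) ≤ 4),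
      div_inv_eq_mul, mul_comm]
  have hinv : a ^ (-α) * a ^ α = 1 := by
    rw [← Real.rpow_add ha0]; simp
  have h3 : u x ≤ C * a ^ (-α) := by
    calc u x = a ^ (-α) * (a ^ α * u x) := by rw [← mul_assoc, hinv, one_mul]
      _ ≤ a ^ (-α) * C := by gcongr
      _ = _ := mul_comm _ _
  have h4 : ‖gradient u x‖ ^ (2 / (p + 1)) ≤ C ^ (2 / (p + 1)) * a ^ (-α) := by
    have h5 : ‖fderiv ℝ u x‖ ≤ C * a ^ (-(α + 1)) := by
      have h6 : a ^ (-(α + 1)) * (a ^ α * a) = 1 := by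
        rw [← Real.rpow_add_one ha0.ne', ← Real.rpow_add ha0]; simp
      calc ‖fderiv ℝ u x‖ = a ^ (-(α + 1)) * (a ^ α * a * ‖fderiv ℝ u x‖) := by
            rw [← mul_assoc, h6, one_mul]
        _ ≤ a ^ (-(α + 1)) * C := by gcongr
        _ = _ := mul_comm _ _
    rw [hgrad]
    calc ‖fderiv ℝ u x‖ ^ (2 / (p + 1)) ≤ (C * a ^ (-(α + 1))) ^ (2 / (p + 1)) := by gcongr
      _ = C ^ (2 / (p + 1)) * a ^ (-α) := by
        rw [Real.mul_rpow hC.le (by positivity), ← Real.rpow_mul ha0.le]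
        congr 2
        rw [hα]
        field_simp
        ring
  calc u x + ‖gradient u x‖ ^ (2 / (p + 1))
      ≤ C * a ^ (-α) + C ^ (2 / (p + 1)) * a ^ (-α) := add_le_add h3 h4
    _ = 4 ^ α * (C + C ^ (2 / (p + 1))) * d ^ (-α) := by rw [← hda]; ring
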